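/- arXiv:2301.00649 — 3 statements merged into one kernel-verified Lean document; each statement's English description precedes it below -/
import Mathlib

section
/- Let ℏ : ℵ → ℝ be a function and ϑ : ℝ^m × [0,1] → ℝ a map. Then ℏ is general s-convex with respect to (the restriction to ℵ of) ϑ if and only if the epigraph E(ℏ) = {(b, β) ∈ ℝ^m × ℝ : b ∈ ℵ, ℏ(b) ≤ β} is a general s-convex set with respect to ϑ. -/
open Set

/-- A function `g` is general `s`-convex on a set `A ⊆ ℝ^m` with respect to a map
`ϑ : ℝ^m × [0,1] → ℝ` if for all `b₁, b₂ ∈ A` and all `σ ∈ [0,1]`,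
`g(σb₁ + (1−σ)b₂) ≤ σ^s (g b₁ + ϑ(b₁,σ)) + (1−σ)^s (g b₂ + ϑ(b₂,σ)) + ϑ((b₁+b₂)/2, σ)`. -/
def GeneralSConvexOn {m : ℕ} (s : ℝ) (A : Set (EuclideanSpace ℝ (Fin m)))
    (g : EuclideanSpace ℝ (Fin m) → ℝ) (ϑ : EuclideanSpace ℝ (Fin m) → ℝ → ℝ) : Prop :=
  ∀ b₁ ∈ A, ∀ b₂ ∈ A, ∀ σ ∈ Icc (0 : ℝ) 1,
    g (σ • b₁ + (1 - σ) • b₂) ≤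
      σ ^ s * (g b₁ + ϑ b₁ σ) + (1 - σ) ^ s * (g b₂ + ϑ b₂ σ) +
        ϑ ((1 / 2 : ℝ) • (b₁ + b₂)) σ

/-- A subset `B ⊆ ℝ^m × ℝ` is a general `s`-convex set with respect to a map
`ϑ : ℝ^m × [0,1] → ℝ` if for all `(b₁,α), (b₂,β) ∈ B` and all `σ ∈ [0,1]`, the point
`(σb₁ + (1−σ)b₂, σ^s (α + ϑ(b₁,σ)) + (1−σ)^s (β + ϑ(b₂,σ)) + ϑ((b₁+b₂)/2, σ))`
belongs to `B`. -/
def GeneralSConvexSet {m : ℕ} (s : ℝ) (B : Set (EuclideanSpace ℝ (Fin m) × ℝ))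
    (ϑ : EuclideanSpace ℝ (Fin m) → ℝ → ℝ) : Prop :=
  ∀ p ∈ B, ∀ q ∈ B, ∀ σ ∈ Icc (0 : ℝ) 1,
    (σ • p.1 + (1 - σ) • q.1,
      σ ^ s * (p.2 + ϑ p.1 σ) + (1 - σ) ^ s * (q.2 + ϑ q.1 σ) +
        ϑ ((1 / 2 : ℝ) • (p.1 + q.1)) σ) ∈ B

/-- `ℏ` is general `s`-convex on `A` w.r.t. `ϑ` iff its epigraph
`{(b, β) : b ∈ A, ℏ b ≤ β}` is a general `s`-convex set w.r.t. `ϑ`. -/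
theorem generalSConvexOn_iff_epigraph {m : ℕ} (s : ℝ) (hs : s ∈ Ioc (0 : ℝ) 1)
    (A : Set (EuclideanSpace ℝ (Fin m))) (hAne : A.Nonempty) (hAconv : Convex ℝ A)
    (ℏ : EuclideanSpace ℝ (Fin m) → ℝ) (ϑ : EuclideanSpace ℝ (Fin m) → ℝ → ℝ) :
    GeneralSConvexOn s A ℏ ϑ ↔
      GeneralSConvexSet s {p : EuclideanSpace ℝ (Fin m) × ℝ | p.1 ∈ A ∧ ℏ p.1 ≤ p.2} ϑ := by
  constructor
  · intro h p hp q hq σ hσ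
    obtain ⟨hp1, hp2⟩ := hp
    obtain ⟨hq1, hq2⟩ := hq
    have h0 : 0 ≤ σ := hσ.1
    have h1 : 0 ≤ 1 - σ := sub_nonneg.mpr hσ.2
    refine ⟨hAconv hp1 hq1 h0 h1 (by ring), (h p.1 hp1 q.1 hq1 σ hσ).trans ?_⟩
    have e1 := mul_le_mul_of_nonneg_left hp2 (Real.rpow_nonneg h0 s)
    have e2 := mul_le_mul_of_nonneg_left hq2 (Real.rpow_nonneg h1 s)
    simp only [mul_add]
    linarith
  · intro h b₁ hb₁ b₂ hb₂ σ hσ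
    exact (h (b₁, ℏ b₁) ⟨hb₁, le_refl _⟩ (b₂, ℏ b₂) ⟨hb₂, le_refl _⟩ σ hσ).2
end

section
/- Let {ℏᵢ : ℵ → ℝ}_{i ∈ K} be a nonempty family of functions, each general s-convex with respect to the same map ϑ : ℵ × [0,1] → ℝ, and suppose that for every b ∈ ℵ the set {ℏᵢ(b) : i ∈ K} is bounded above. Then the pointwise supremum ℏ(b) = sup_{i ∈ K} ℏᵢ(b) is a general s-convex function with respect to ϑ. -/
open Set

/-- The pointwise supremum of a nonempty family of general `s`-convex functions w.r.t.
the same map `ϑ`, bounded above at each point of `A`, is general `s`-convex w.r.t. `ϑ`. -/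
theorem iSup_generalSConvexOn {m : ℕ} {ι : Type*} (hι : Nonempty ι)
    (s : ℝ) (hs : s ∈ Ioc (0 : ℝ) 1)
    (A : Set (EuclideanSpace ℝ (Fin m))) (hAne : A.Nonempty) (hAconv : Convex ℝ A)
    (ℏ : ι → EuclideanSpace ℝ (Fin m) → ℝ) (ϑ : EuclideanSpace ℝ (Fin m) → ℝ → ℝ)
    (h : ∀ i, GeneralSConvexOn s A (ℏ i) ϑ)
    (hbdd : ∀ b ∈ A, BddAbove (Set.range fun i => ℏ i b)) :
    GeneralSConvexOn s A (fun b => ⨆ i, ℏ i b) ϑ := by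
  intro b₁ h₁ b₂ h₂ σ hσ
  have p1 : (0 : ℝ) ≤ σ ^ s := Real.rpow_nonneg hσ.1 s
  have p2 : (0 : ℝ) ≤ (1 - σ) ^ s := Real.rpow_nonneg (sub_nonneg.2 hσ.2) s
  refine ciSup_le fun i => (h i b₁ h₁ b₂ h₂ σ hσ).trans ?_
  have e1 : ℏ i b₁ ≤ ⨆ i, ℏ i b₁ := le_ciSup (hbdd b₁ h₁) i
  have e2 : ℏ i b₂ ≤ ⨆ i, ℏ i b₂ := le_ciSup (hbdd b₂ h₂) i
  have f1 := mul_le_mul_of_nonneg_left (add_le_add_left e1 (ϑ b₁ σ)) p1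
  have f2 := mul_le_mul_of_nonneg_left (add_le_add_left e2 (ϑ b₂ σ)) p2
  exact add_le_add (add_le_add f1 f2) le_rfl
end

section
/- Let ℏ : ℝ^m → ℝ be a nonnegative differentiable function that is strictly general s-convex with respect to ϑ : ℝ^m × [0,1] → ℝ, and let b₂ ∈ ℝ^m. Suppose that for every b₁ ∈ ℝ^m the standing limit assumption holds for the pair (b₁, b₂) with limit L(b₁), and that for every b₁ ∈ ℝ^m and every σ ∈ (0,1] the inequality ⟨∇ℏ(b₂), b₁ − b₂⟩ − ℏ(b₂)/σ − ϑ(b₂,σ)/σ − L(b₁) ≥ σ^{s−1}[ϑ(b₁,σ) − ϑ(b₂,σ)] holds. Then b₂ is the unique optimal solution of the problem min{ℏ(b) : b ∈ ℝ^m}, i.e., ℏ(b₂) < ℏ(b₁) for every b₁ ≠ b₂. -/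
open Set Filter
open scoped RealInnerProductSpace Topology

/-- A function `g : ℝ^m → ℝ` is general `s`-convex with respect to a map
`ϑ : ℝ^m × [0,1] → ℝ` if for all `b₁, b₂ ∈ ℝ^m` and all `σ ∈ [0,1]`,
`g(σb₁ + (1−σ)b₂) ≤ σ^s (g b₁ + ϑ(b₁,σ)) + (1−σ)^s (g b₂ + ϑ(b₂,σ)) + ϑ((b₁+b₂)/2, σ)`. -/
def GeneralSConvex {m : ℕ} (s : ℝ) (g : EuclideanSpace ℝ (Fin m) → ℝ)
    (ϑ : EuclideanSpace ℝ (Fin m) → ℝ → ℝ) : Prop :=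
  ∀ b₁ b₂ : EuclideanSpace ℝ (Fin m), ∀ σ ∈ Icc (0 : ℝ) 1,
    g (σ • b₁ + (1 - σ) • b₂) ≤
      σ ^ s * (g b₁ + ϑ b₁ σ) + (1 - σ) ^ s * (g b₂ + ϑ b₂ σ) +
        ϑ ((1 / 2 : ℝ) • (b₁ + b₂)) σ

/-- The standing limit assumption for a function `g`, a map `ϑ`, and an ordered pair
`(b₁, b₂)`, with limit `L`: `ϑ((b₁+b₂)/2, σ)/σ → L` as `σ → 0⁺`, and for every
`σ ∈ (0,1]`, `(ϑ((b₁+b₂)/2, σ) − ϑ(b₂,σ) − r(σ))/σ ≤ L`, where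
`r(σ) = g(b₂ + σ(b₁−b₂)) − g(b₂) − σ⟨∇g(b₂), b₁−b₂⟩` is the first-order Taylor
remainder of `g` at `b₂`. -/
def StandingLimit {m : ℕ} (g : EuclideanSpace ℝ (Fin m) → ℝ)
    (ϑ : EuclideanSpace ℝ (Fin m) → ℝ → ℝ)
    (b₁ b₂ : EuclideanSpace ℝ (Fin m)) (L : ℝ) : Prop :=
  Tendsto (fun σ : ℝ => ϑ ((1 / 2 : ℝ) • (b₁ + b₂)) σ / σ) (𝓝[>] (0 : ℝ)) (𝓝 L) ∧
  ∀ σ ∈ Ioc (0 : ℝ) 1,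
    (ϑ ((1 / 2 : ℝ) • (b₁ + b₂)) σ - ϑ b₂ σ -
      (g (b₂ + σ • (b₁ - b₂)) - g b₂ - σ * ⟪gradient g b₂, b₁ - b₂⟫)) / σ ≤ L

/-- A function `g : ℝ^m → ℝ` is strictly general `s`-convex with respect to a map
`ϑ : ℝ^m × [0,1] → ℝ` if for all `b₁ ≠ b₂` and all `σ ∈ (0,1)`, the defining inequality
holds strictly. -/
def StrictGeneralSConvex {m : ℕ} (s : ℝ) (g : EuclideanSpace ℝ (Fin m) → ℝ)
    (ϑ : EuclideanSpace ℝ (Fin m) → ℝ → ℝ) : Prop :=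
  ∀ b₁ b₂ : EuclideanSpace ℝ (Fin m), b₁ ≠ b₂ → ∀ σ ∈ Ioo (0 : ℝ) 1,
    g (σ • b₁ + (1 - σ) • b₂) <
      σ ^ s * (g b₁ + ϑ b₁ σ) + (1 - σ) ^ s * (g b₂ + ϑ b₂ σ) +
        ϑ ((1 / 2 : ℝ) • (b₁ + b₂)) σ

/-- Corollary 3.2: under strict general `s`-convexity, the sufficient optimality condition
yields a unique optimal solution of `min {ℏ(b) : b ∈ ℝ^m}`. -/
theorem unconstrained_optimality_unique {m : ℕ} (s : ℝ) (hs : s ∈ Ioc (0 : ℝ) 1)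
    (ℏ : EuclideanSpace ℝ (Fin m) → ℝ) (ϑ : EuclideanSpace ℝ (Fin m) → ℝ → ℝ)
    (hnn : ∀ b, 0 ≤ ℏ b) (hdiff : Differentiable ℝ ℏ)
    (hconv : StrictGeneralSConvex s ℏ ϑ)
    (b₂ : EuclideanSpace ℝ (Fin m))
    (L : EuclideanSpace ℝ (Fin m) → ℝ)
    (hsl : ∀ b₁, StandingLimit ℏ ϑ b₁ b₂ (L b₁))
    (hineq : ∀ b₁, ∀ σ ∈ Ioc (0 : ℝ) 1,
      ⟪gradient ℏ b₂, b₁ - b₂⟫ - ℏ b₂ / σ - ϑ b₂ σ / σ - L b₁ ≥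
        σ ^ (s - 1) * (ϑ b₁ σ - ϑ b₂ σ)) :
    ∀ b₁, b₁ ≠ b₂ → ℏ b₂ < ℏ b₁ := by
  intro b₁ hne
  have hmid : (1 / 2 : ℝ) • (b₂ + b₂) = b₂ := by
    rw [← two_smul ℝ b₂, smul_smul]; norm_num
  obtain ⟨hlim, hr⟩ := hsl b₂
  rw [hmid] at hlim
  have hL : 0 ≤ L b₂ := by
    have := hr 1 (by norm_num)
    rw [hmid] at this
    simpa using this
  have hB : ∀ σ ∈ Ioc (0 : ℝ) 1, ϑ b₂ σ ≤ - ℏ b₂ := by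
    intro σ hσ
    have h := hineq b₂ σ hσ
    simp only [sub_self, inner_zero_right, mul_zero, zero_sub] at h
    have h1 : (ℏ b₂ + ϑ b₂ σ) / σ ≤ 0 := by rw [add_div]; linarith
    have h2 : ℏ b₂ + ϑ b₂ σ ≤ 0 := by
      by_contra hc
      push Not at hc
      have := div_pos hc hσ.1
      linarith
    linarith
  have hid : Tendsto (fun σ : ℝ => σ) (𝓝[>] (0 : ℝ)) (𝓝 0) :=
    tendsto_id.mono_left nhdsWithin_le_nhds
  have hB0 : Tendsto (fun σ : ℝ => ϑ b₂ σ / σ * σ) (𝓝[>] (0 : ℝ)) (𝓝 (L b₂ * 0)) :=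
    hlim.mul hid
  have hle : L b₂ * 0 ≤ - ℏ b₂ := by
    refine le_of_tendsto hB0 ?_
    filter_upwards [Ioc_mem_nhdsGT (zero_lt_one' ℝ)] with σ hσ
    rw [div_mul_cancel₀ _ hσ.1.ne']
    exact hB σ hσ
  have h0 : ℏ b₂ = 0 := le_antisymm (by linarith) (hnn b₂)
  have hBh := hB (1/2) (by constructor <;> norm_num)
  have hc := hconv b₁ b₂ hne (1/2) (by constructor <;> norm_num)
  have hs1 := (hsl b₁).2 (1/2) (by constructor <;> norm_num)
  have hi := hineq b₁ (1/2) (by constructor <;> norm_num)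
  have hv : (1 / 2 : ℝ) • b₁ + (1 - 1 / 2 : ℝ) • b₂ = b₂ + (1 / 2 : ℝ) • (b₁ - b₂) := by
    module
  have hp : (1 / 2 : ℝ) ^ (s - 1) = (1 / 2 : ℝ) ^ s * 2 := by
    rw [Real.rpow_sub (by norm_num), Real.rpow_one]; ring
  have hpos : 0 < (1 / 2 : ℝ) ^ s := by positivity
  rw [hv, show (1 - 1 / 2 : ℝ) = 1 / 2 by norm_num] at hc
  rw [hp] at hi
  rw [div_le_iff₀ (by norm_num)] at hs1
  rw [h0] at *
  generalize (1 / 2 : ℝ) ^ s = p at *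
  have hk : 0 < p * (ℏ b₁ + 2 * ϑ b₂ (1/2)) := by linarith
  have := pos_of_mul_pos_right hk hpos.le
  linarith
end
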